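/- Let I be a nonempty finite index set, let (X_i)_{i∈I} be measurable spaces, and let μ be a probability measure on the product space Π_{i∈I} X_i with i-th marginal μ_i (the pushforward of μ under the i-th coordinate projection). Then for every family (ν_i)_{i∈I} of probability measures on the spaces X_i, D(μ ‖ ⊗_{i∈I} μ_i) ≤ D(μ ‖ ⊗_{i∈I} ν_i); that is, the product of the marginals of μ minimizes the Kullback–Leibler divergence from μ over all product probability measures. -/

import Mathlib

open MeasureTheory
open scoped ENNReal NNReal Classical

/-- The Kullback–Leibler divergence `D(μ‖ν) ∈ [0,∞]`: it equals
`∫ log(dμ/dν) dμ` when `μ ≪ ν` (and this integral is well defined),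
and `+∞` otherwise. -/
noncomputable def klDiv {α : Type*} [MeasurableSpace α] (μ ν : Measure α) : ℝ≥0∞ :=
  if μ ≪ ν ∧ Integrable (fun x => Real.log ((μ.rnDeriv ν x).toReal)) μ then
    ENNReal.ofReal (∫ x, Real.log ((μ.rnDeriv ν x).toReal) ∂μ)
  else ⊤

/-- A finite product of probability measures with densities has the product density. -/
lemma pi_withDensity_eq_withDensity_prod
    {I : Type*} [Fintype I] {X : I → Type*} [∀ i, MeasurableSpace (X i)]
    (ν : ∀ i, Measure (X i)) [∀ i, IsProbabilityMeasure (ν i)]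
    {f : ∀ i, X i → ℝ≥0∞} (hf : ∀ i, Measurable (f i))
    [∀ i, SigmaFinite ((ν i).withDensity (f i))] :
    Measure.pi (fun i => (ν i).withDensity (f i)) =
      (Measure.pi ν).withDensity (fun x => ∏ i, f i (x i)) := by
  refine Measure.pi_eq fun s hs => ?_
  rw [withDensity_apply _ (MeasurableSet.univ_pi hs),
    ← lintegral_indicator (MeasurableSet.univ_pi hs)]
  have hind : (Set.univ.pi s).indicator (fun x => ∏ i, f i (x i)) =
      fun x => ∏ i, (s i).indicator (f i) (x i) := by
    ext x
    by_cases hx : x ∈ Set.univ.pi s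
    · rw [Set.indicator_of_mem hx]
      exact Finset.prod_congr rfl fun i _ => (Set.indicator_of_mem (hx i trivial) _).symm
    · rw [Set.indicator_of_notMem hx]
      obtain ⟨i, hi⟩ : ∃ i, x i ∉ s i := by simpa using hx
      exact (Finset.prod_eq_zero (Finset.mem_univ i) (Set.indicator_of_notMem hi _)).symm
  have hmeas : ∀ i, Measurable ((s i).indicator (f i)) := fun i => (hf i).indicator (hs i)
  rw [hind]
  refine (ProbabilityTheory.lintegral_prod_eq_prod_lintegral_of_indepFun Finset.univ
    (fun i (x : ∀ i, X i) => (s i).indicator (f i) (x i))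
    (ProbabilityTheory.iIndepFun_pi fun i => (hmeas i).aemeasurable)
    (fun i => (hmeas i).comp (measurable_pi_apply i))).trans ?_
  refine Finset.prod_congr rfl fun i _ => ?_
  rw [(measurePreserving_eval ν i).lintegral_comp (hmeas i), lintegral_indicator (hs i),
    withDensity_apply _ (hs i)]

/-- The product of the marginals of `μ` minimises the Kullback–Leibler divergence
from `μ` over all product probability measures. -/
theorem product_of_marginals_minimises_klDiv
    {I : Type*} [Fintype I] [Nonempty I] {X : I → Type*}
    [∀ i, MeasurableSpace (X i)]
    (μ : Measure (∀ i, X i)) [IsProbabilityMeasure μ]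
    (ν : ∀ i, Measure (X i)) [∀ i, IsProbabilityMeasure (ν i)] :
    klDiv μ (Measure.pi (fun i => Measure.map (fun x => x i) μ)) ≤
      klDiv μ (Measure.pi ν) := by
  by_cases h : μ ≪ Measure.pi ν ∧ Integrable (llr μ (Measure.pi ν)) μ
  swap
  · exact le_top.trans_eq (if_neg h).symm
  obtain ⟨hac, hint⟩ := h
  have heval : ∀ i, Measurable (fun x : ∀ i, X i => x i) := measurable_pi_apply
  set m : ∀ i, Measure (X i) := fun i => μ.map (fun x => x i)
  have hprob : ∀ i, IsProbabilityMeasure (m i) := fun i =>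
    Measure.isProbabilityMeasure_map (heval i).aemeasurable
  have hν : ∀ i, (Measure.pi ν).map (fun x => x i) = ν i := fun i =>
    (measurePreserving_eval ν i).map_eq
  have hm_ac : ∀ i, m i ≪ ν i := fun i => hν i ▸ hac.map (heval i)
  have hm_int : ∀ i, Integrable (llr (m i) (ν i)) (m i) := fun i =>
    hν i ▸ InformationTheory.integrable_llr_map hac (heval i) hint
  set g : (∀ i, X i) → ℝ≥0∞ := fun x => ∏ i, (m i).rnDeriv (ν i) (x i) with hg
  have hg_meas : Measurable g := by fun_prop
  have hpi : Measure.pi m = (Measure.pi ν).withDensity g := by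
    have hd : ∀ i, (ν i).withDensity ((m i).rnDeriv (ν i)) = m i := fun i =>
      Measure.withDensity_rnDeriv_eq _ _ (hm_ac i)
    have (i : I) : SigmaFinite ((ν i).withDensity ((m i).rnDeriv (ν i))) := by
      rw [hd i]; infer_instance
    rw [← pi_withDensity_eq_withDensity_prod ν fun i => Measure.measurable_rnDeriv (m i) (ν i)]
    simp_rw [hd]
  have hpos : ∀ᵐ x ∂μ, ∀ i, 0 < (m i).rnDeriv (ν i) (x i) :=
    ae_all_iff.2 fun i => ae_of_ae_map (heval i).aemeasurable (Measure.rnDeriv_pos (hm_ac i))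
  have hfin : ∀ᵐ x ∂μ, ∀ i, (m i).rnDeriv (ν i) (x i) < ∞ :=
    ae_all_iff.2 fun i => ae_of_ae_map (heval i).aemeasurable
      ((hm_ac i).ae_le (Measure.rnDeriv_lt_top (m i) (ν i)))
  have hac' : μ ≪ Measure.pi m := by
    refine Measure.AbsolutelyContinuous.mk fun s hs h0 => ?_
    rw [hpi, withDensity_apply_eq_zero hg_meas] at h0
    refine measure_mono_null_ae ?_ (hac h0)
    filter_upwards [hpos] with x hx hxs
    exact ⟨Finset.prod_ne_zero_iff.2 fun i _ => (hx i).ne', hxs⟩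
  have hllr : llr μ (Measure.pi ν) =ᵐ[μ]
      fun x => llr μ (Measure.pi m) x + ∑ i, llr (m i) (ν i) (x i) := by
    have hrn : (Measure.pi m).rnDeriv (Measure.pi ν) =ᵐ[Measure.pi ν] g :=
      hpi ▸ Measure.rnDeriv_withDensity _ hg_meas
    filter_upwards [hac.ae_le hrn, hac.ae_le (Measure.rnDeriv_mul_rnDeriv hac'), hpos, hfin,
      Measure.rnDeriv_pos hac', hac'.ae_le (Measure.rnDeriv_lt_top μ (Measure.pi m))]
      with x hgx hmul hpx hfx hp ht
    have hne : ∀ i, ((m i).rnDeriv (ν i) (x i)).toReal ≠ 0 := fun i =>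
      (ENNReal.toReal_pos (hpx i).ne' (hfx i).ne).ne'
    rw [Pi.mul_apply, hgx] at hmul
    simp only [llr]
    rw [← hmul, ENNReal.toReal_mul, hg, ENNReal.toReal_prod,
      Real.log_mul (ENNReal.toReal_pos hp.ne' ht.ne).ne'
        (Finset.prod_ne_zero_iff.2 fun i _ => hne i),
      Real.log_prod fun i _ => hne i]
  have hcomp_int : ∀ i, Integrable (fun x => llr (m i) (ν i) (x i)) μ := fun i =>
    (hm_int i).comp_measurable (heval i)
  have hsum_int : Integrable (fun x => ∑ i, llr (m i) (ν i) (x i)) μ :=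
    integrable_finsetSum _ fun i _ => hcomp_int i
  have hint' : Integrable (llr μ (Measure.pi m)) μ := by
    refine (hint.sub hsum_int).congr ?_
    filter_upwards [hllr] with x hx
    simp [hx]
  have hsum_nonneg : 0 ≤ ∫ x, ∑ i, llr (m i) (ν i) (x i) ∂μ := by
    rw [integral_finsetSum _ fun i _ => hcomp_int i]
    refine Finset.sum_nonneg fun i _ => ?_
    rw [← integral_map (heval i).aemeasurable (hm_int i).aestronglyMeasurable]
    simpa using InformationTheory.integral_llr_add_sub_measure_univ_nonneg (hm_ac i) (hm_int i)
  have hle : ∫ x, llr μ (Measure.pi m) x ∂μ ≤ ∫ x, llr μ (Measure.pi ν) x ∂μ := by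
    rw [integral_congr_ae hllr, integral_add hint' hsum_int]
    exact le_add_of_nonneg_right hsum_nonneg
  rw [klDiv, klDiv, if_pos ⟨hac', hint'⟩, if_pos ⟨hac, hint⟩]
  exact ENNReal.ofReal_le_ofReal hle
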